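/- arXiv:1008.0204 — 4 statements merged into one kernel-verified Lean document; each statement's English description precedes it below -/
import Mathlib

section
/- Let N ≥ 1 and Δ ⊆ 2^{{1,…,N}}, and let E_Δ be the exponential family on {0,1}^N consisting of the distributions p_θ(x) = exp(∑_{λ∈Δ} θ_λ (−1)^{|supp(x) ∩ λ|}) / ∑_{z∈{0,1}^N} exp(∑_{λ∈Δ} θ_λ (−1)^{|supp(z) ∩ λ|}) for θ ∈ ℝ^Δ, where supp(x) = {i : x_i = 1}. For x ∈ {0,1}^N and Y ⊆ {0,1}^N define x*Y = {x ⊕ y : y ∈ Y}, where ⊕ is coordinatewise addition modulo 2. Then for every x ∈ {0,1}^N: Y is an S-set for E_Δ if and only if x*Y is an S-set for E_Δ; and Y is the support of some element of the closure of E_Δ if and only if x*Y is the support of some element of the closure of E_Δ. -/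
/-- A probability distribution on a finite set `X`. -/
def IsDist {X : Type*} [Fintype X] (p : X → ℝ) : Prop :=
  (∀ x, 0 ≤ p x) ∧ ∑ x, p x = 1

/-- `Y` is an S-set for the family `E`: every distribution supported in `Y`
lies in the closure of `E`. -/
def IsSSet {X : Type*} [Fintype X] (E : Set (X → ℝ)) (Y : Set X) : Prop :=
  ∀ p : X → ℝ, IsDist p → {x | 0 < p x} ⊆ Y → p ∈ closure E

/-- The character `x ↦ (-1)^(|supp x ∩ s|)` on `{0,1}^N`. -/
def chi {N : ℕ} (s : Finset (Fin N)) (x : Fin N → Fin 2) : ℝ :=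
  (-1) ^ (s.filter fun i => x i = 1).card

/-- The exponential family on `{0,1}^N` with sufficient statistics the
characters indexed by `Δ ⊆ 2^[N]`. -/
def expFamDelta {N : ℕ} (Δ : Finset (Finset (Fin N))) :
    Set ((Fin N → Fin 2) → ℝ) :=
  {p | ∃ θ : Finset (Fin N) → ℝ, ∀ x, p x =
    Real.exp (∑ s ∈ Δ, θ s * chi s x) /
      ∑ z, Real.exp (∑ s ∈ Δ, θ s * chi s z)}

theorem chi_eq_prod {N : ℕ} (s : Finset (Fin N)) (x : Fin N → Fin 2) :
    chi s x = ∏ i ∈ s, if x i = 1 then (-1 : ℝ) else 1 := by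
  simp [chi, Finset.prod_ite]

theorem chi_add {N : ℕ} (s : Finset (Fin N)) (x y : Fin N → Fin 2) :
    chi s (x + y) = chi s x * chi s y := by
  simp only [chi_eq_prod, ← Finset.prod_mul_distrib, Pi.add_apply]
  refine Finset.prod_congr rfl fun i _ => ?_
  have h (a : Fin 2) : a = 0 ∨ a = 1 := by revert a; decide
  rcases h (x i) with hx | hx <;> rcases h (y i) with hy | hy <;> simp [hx, hy]

theorem add_add_self_cube {N : ℕ} (x z : Fin N → Fin 2) : x + (x + z) = z := by
  funext i
  simp only [Pi.add_apply]
  generalize x i = a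
  generalize z i = b
  revert a b
  decide

theorem image_add_image_add {N : ℕ} (x : Fin N → Fin 2) (Y : Set (Fin N → Fin 2)) :
    (fun z => x + z) '' ((fun z => x + z) '' Y) = Y := by
  simp only [Set.image_image, add_add_self_cube, Set.image_id']

theorem sum_translate_cube {N : ℕ} (x : Fin N → Fin 2) (f : (Fin N → Fin 2) → ℝ) :
    ∑ z, f (x + z) = ∑ z, f z :=
  Fintype.sum_equiv (Equiv.addLeft x) _ _ fun _ => rfl

theorem translate_mem_expFamDelta {N : ℕ} {Δ : Finset (Finset (Fin N))}
    (x : Fin N → Fin 2) {p : (Fin N → Fin 2) → ℝ} (hp : p ∈ expFamDelta Δ) :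
    (fun z => p (x + z)) ∈ expFamDelta Δ := by
  obtain ⟨θ, hθ⟩ := hp
  refine ⟨fun s => θ s * chi s x, fun z => ?_⟩
  simp only [hθ, mul_assoc, ← chi_add]
  rw [sum_translate_cube x fun z => Real.exp (∑ s ∈ Δ, θ s * chi s z)]

theorem translate_mem_closure_expFamDelta {N : ℕ} {Δ : Finset (Finset (Fin N))}
    (x : Fin N → Fin 2) {p : (Fin N → Fin 2) → ℝ} (hp : p ∈ closure (expFamDelta Δ)) :
    (fun z => p (x + z)) ∈ closure (expFamDelta Δ) :=
  map_mem_closure (f := fun (p : (Fin N → Fin 2) → ℝ) z => p (x + z)) (by fun_prop) hp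
    fun _ => translate_mem_expFamDelta x

theorem IsSSet.translate {N : ℕ} {Δ : Finset (Finset (Fin N))} {Y : Set (Fin N → Fin 2)}
    (hY : IsSSet (expFamDelta Δ) Y) (x : Fin N → Fin 2) :
    IsSSet (expFamDelta Δ) ((fun z => x + z) '' Y) := by
  intro p hp hsupp
  have h := hY (fun z => p (x + z)) ⟨fun z => hp.1 _, (sum_translate_cube x p).trans hp.2⟩ ?_
  · simpa only [add_add_self_cube] using translate_mem_closure_expFamDelta x h
  · intro z hz
    obtain ⟨y, hy, hyz⟩ := hsupp hz
    rwa [← add_left_cancel hyz]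

theorem exists_support_translate {N : ℕ} {Δ : Finset (Finset (Fin N))}
    {Y : Set (Fin N → Fin 2)} (x : Fin N → Fin 2)
    (hY : ∃ g ∈ closure (expFamDelta Δ), {z | 0 < g z} = Y) :
    ∃ g ∈ closure (expFamDelta Δ), {z | 0 < g z} = (fun z => x + z) '' Y := by
  obtain ⟨g, hg, rfl⟩ := hY
  refine ⟨_, translate_mem_closure_expFamDelta x hg, ?_⟩
  ext z
  constructor
  · exact fun hz => ⟨x + z, hz, add_add_self_cube x z⟩
  · rintro ⟨y, hy, rfl⟩
    simpa only [Set.mem_ofPred_eq, add_add_self_cube] using hy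

/-- for the hierarchical exponential family `E_Δ`, translating a
set `Y` by coordinatewise addition mod 2 with any `x` preserves both the S-set
property and the property of being a support set of an element of the closure. -/
theorem stmt_16 (N : ℕ) (hN : 1 ≤ N) (Δ : Finset (Finset (Fin N)))
    (Y : Set (Fin N → Fin 2)) (x : Fin N → Fin 2) :
    (IsSSet (expFamDelta Δ) Y ↔ IsSSet (expFamDelta Δ) ((fun z => x + z) '' Y)) ∧
    ((∃ g ∈ closure (expFamDelta Δ), {z | 0 < g z} = Y) ↔
      (∃ g ∈ closure (expFamDelta Δ), {z | 0 < g z} = (fun z => x + z) '' Y)) := by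
  refine ⟨⟨fun h => h.translate x, fun h => ?_⟩, exists_support_translate x, fun h => ?_⟩
  · simpa only [image_add_image_add] using h.translate x
  · simpa only [image_add_image_add] using exists_support_translate x h
end

section
/- Let X = X_1 × ⋯ × X_N with each X_i finite, let 1 ≤ k ≤ N, and let p be a probability distribution on X. If supp(p) can be covered by m cylinder sets of dimension k, or if m·(2^k − 1) ≥ |supp(p)|, then p is a convex combination of m elements of the closure of the k-interaction exponential family E^k. -/
/-- `g` depends only on the coordinates in `s`. -/
def DependsOnlyOn {N : ℕ} {X : Fin N → Type*} (s : Finset (Fin N))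
    (g : ((i : Fin N) → X i) → ℝ) : Prop :=
  ∀ x y, (∀ i ∈ s, x i = y i) → g x = g y

/-- The `k`-interaction exponential family on `X = X_1 × ⋯ × X_N`. -/
def interactionFamily (k : ℕ) {N : ℕ} {X : Fin N → Type*} [∀ i, Fintype (X i)] :
    Set (((i : Fin N) → X i) → ℝ) :=
  {p | ∃ F : Finset (Fin N) → ((i : Fin N) → X i) → ℝ,
    (∀ s, DependsOnlyOn s (F s)) ∧ (∀ s, k < s.card → F s = 0) ∧
    ∀ x, p x = Real.exp (∑ s, F s x) / ∑ y, Real.exp (∑ s, F s y)}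

/-- The linear space of functions spanned by those depending on at most `k` coordinates. -/
def interactionSpace (k : ℕ) {N : ℕ} (X : Fin N → Type*) :
    Submodule ℝ (((i : Fin N) → X i) → ℝ) :=
  Submodule.span ℝ {g | ∃ s : Finset (Fin N), s.card ≤ k ∧ DependsOnlyOn s g}

section InteractionSpace

variable {N : ℕ} {X : Fin N → Type*}

lemma DependsOnlyOn.mem_interactionSpace {k : ℕ} {s : Finset (Fin N)}
    {g : ((i : Fin N) → X i) → ℝ} (hg : DependsOnlyOn s g) (hs : s.card ≤ k) :
    g ∈ interactionSpace k X :=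
  Submodule.subset_span ⟨s, hs, hg⟩

lemma const_mem_interactionSpace (k : ℕ) (c : ℝ) :
    (fun _ => c) ∈ interactionSpace k X :=
  DependsOnlyOn.mem_interactionSpace (s := ∅) (fun _ _ _ => rfl) (by simp)

lemma exists_sum_eq_of_mem_interactionSpace {k : ℕ} {h : ((i : Fin N) → X i) → ℝ}
    (hh : h ∈ interactionSpace k X) :
    ∃ F : Finset (Fin N) → ((i : Fin N) → X i) → ℝ,
      (∀ s, DependsOnlyOn s (F s)) ∧ (∀ s, k < s.card → F s = 0) ∧
      ∀ x, h x = ∑ s, F s x := by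
  induction hh using Submodule.span_induction with
  | mem g hg =>
    obtain ⟨s, hs, hg⟩ := hg
    refine ⟨fun t => if t = s then g else 0, fun t => ?_, fun t ht => ?_, fun x => ?_⟩
    · by_cases hts : t = s
      · subst hts; simpa using hg
      · intro x y _; simp [hts]
    · have : t ≠ s := by rintro rfl; omega
      simp [this]
    · rw [Finset.sum_eq_single s]
      · simp
      · intro t _ ht; simp [ht]
      · simp
  | zero => exact ⟨0, fun s x y _ => rfl, fun s _ => rfl, fun x => by simp⟩
  | add f g _ _ hf hg =>
    obtain ⟨F, hF, hF0, hFs⟩ := hf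
    obtain ⟨G, hG, hG0, hGs⟩ := hg
    refine ⟨fun s => F s + G s, fun s x y hxy => ?_, fun s hs => ?_, fun x => ?_⟩
    · simp [hF s x y hxy, hG s x y hxy]
    · simp [hF0 s hs, hG0 s hs]
    · simp [hFs, hGs, Finset.sum_add_distrib]
  | smul c f _ hf =>
    obtain ⟨F, hF, hF0, hFs⟩ := hf
    refine ⟨fun s => c • F s, fun s x y hxy => ?_, fun s hs => ?_, fun x => ?_⟩
    · simp [hF s x y hxy]
    · simp [hF0 s hs]
    · simp [hFs, Finset.mul_sum]

lemma mul_coord_mem_interactionSpace {k : ℕ} {h : ((i : Fin N) → X i) → ℝ}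
    (hh : h ∈ interactionSpace k X) (i : Fin N) (u : X i → ℝ) :
    (fun x => u (x i) * h x) ∈ interactionSpace (k + 1) X := by
  induction hh using Submodule.span_induction with
  | mem g hg =>
    obtain ⟨s, hs, hg⟩ := hg
    refine DependsOnlyOn.mem_interactionSpace (s := insert i s) (fun x y hxy => ?_)
      ((Finset.card_insert_le _ _).trans (by omega))
    rw [hxy i (Finset.mem_insert_self _ _),
      hg x y fun j hj => hxy j (Finset.mem_insert_of_mem hj)]
  | zero => simpa using const_mem_interactionSpace (X := X) (k + 1) 0
  | add f g _ _ hf hg =>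
    convert Submodule.add_mem _ hf hg using 1
    ext x; simp [mul_add]
  | smul c f _ hf =>
    convert Submodule.smul_mem _ c hf using 1
    ext x; simp [mul_left_comm]

variable [∀ i, Fintype (X i)]

lemma exp_div_mem_interactionFamily {k : ℕ} {h : ((i : Fin N) → X i) → ℝ}
    (hh : h ∈ interactionSpace k X) :
    (fun x => Real.exp (h x) / ∑ y, Real.exp (h y)) ∈ interactionFamily k (X := X) := by
  obtain ⟨F, hF, hF0, hFs⟩ := exists_sum_eq_of_mem_interactionSpace hh
  exact ⟨F, hF, hF0, fun x => by simp [hFs]⟩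

/-- A distribution whose support is the zero set of a nonnegative interaction function, and whose
logarithm on the support extends to an interaction function, is in the closure of the family. -/
lemma mem_closure_interactionFamily {k : ℕ} {p : ((i : Fin N) → X i) → ℝ} (hp : IsDist p)
    {h₁ h₂ : ((i : Fin N) → X i) → ℝ}
    (hh₁ : h₁ ∈ interactionSpace k X) (hh₂ : h₂ ∈ interactionSpace k X)
    (hlog : ∀ x, 0 < p x → h₁ x = Real.log (p x)) (hzero : ∀ x, 0 < p x → h₂ x = 0)
    (hpos : ∀ x, p x = 0 → 0 < h₂ x) :
    p ∈ closure (interactionFamily k) := by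
  have hexp : ∀ x, Filter.Tendsto (fun n : ℕ => Real.exp (h₁ x - n * h₂ x)) Filter.atTop
      (nhds (p x)) := by
    intro x
    rcases (hp.1 x).eq_or_lt' with h0 | h0
    · rw [h0]
      refine Real.tendsto_exp_atBot.comp ?_
      simp only [sub_eq_add_neg]
      refine Filter.tendsto_atBot_add_const_left _ _ ?_
      exact Filter.tendsto_neg_atTop_atBot.comp
        (tendsto_natCast_atTop_atTop.atTop_mul_const (hpos x h0))
    · simp [hlog x h0, hzero x h0, Real.exp_log h0]
  have hsum : Filter.Tendsto (fun n : ℕ => ∑ y, Real.exp (h₁ y - n * h₂ y)) Filter.atTop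
      (nhds 1) := by
    rw [← hp.2]
    exact tendsto_finsetSum _ fun y _ => hexp y
  refine mem_closure_of_tendsto (b := Filter.atTop)
    (f := fun (n : ℕ) x => Real.exp (h₁ x - n * h₂ x) / ∑ y, Real.exp (h₁ y - n * h₂ y))
    ?_ (Filter.Eventually.of_forall fun n => ?_)
  · rw [tendsto_pi_nhds]
    intro x
    have h := (hexp x).div hsum one_ne_zero
    rw [div_one] at h
    exact h
  · exact exp_div_mem_interactionFamily
      (Submodule.sub_mem _ hh₁ (Submodule.smul_mem _ (n : ℝ) hh₂))

open Classical in
/-- A distribution supported in a cylinder set of dimension at most `k` is in the closure of the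
`k`-interaction family. -/
lemma mem_closure_of_support_subset_cylinder {k : ℕ} (hk : 1 ≤ k)
    {p : ((i : Fin N) → X i) → ℝ} (hp : IsDist p) {Λ : Finset (Fin N)} (hΛ : Λ.card ≤ k)
    {y : (i : Fin N) → X i} (hsupp : ∀ x, 0 < p x → ∀ j ∉ Λ, x j = y j) :
    p ∈ closure (interactionFamily k) := by
  let r : ((i : Fin N) → X i) → (i : Fin N) → X i := fun x i => if i ∈ Λ then x i else y i
  have hr : ∀ x x', (∀ i ∈ Λ, x i = x' i) → r x = r x' := by
    intro x x' h
    ext i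
    by_cases hi : i ∈ Λ <;> simp [r, hi, h]
  have hfix : ∀ x, (∀ j ∉ Λ, x j = y j) → r x = x := by
    intro x h
    ext i
    by_cases hi : i ∈ Λ <;> simp [r, hi, h]
  refine mem_closure_interactionFamily hp (h₁ := fun x => Real.log (p (r x)))
    (h₂ := (fun x => if p (r x) = 0 then 1 else 0) +
      ∑ j ∈ Λᶜ, fun x => if x j = y j then (0 : ℝ) else 1) ?_ ?_ ?_ ?_ ?_
  · exact DependsOnlyOn.mem_interactionSpace (fun x x' h => by simp only [hr x x' h]) hΛ
  · refine Submodule.add_mem _ (DependsOnlyOn.mem_interactionSpace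
      (fun x x' h => by simp only [hr x x' h]) hΛ) (Submodule.sum_mem _ fun j _ => ?_)
    exact DependsOnlyOn.mem_interactionSpace (s := {j})
      (fun x x' h => by simp only [h j (by simp)]) (by simpa using hk)
  · intro x hx
    simp only [hfix x (hsupp x hx)]
  · intro x hx
    have h0 : ∑ j ∈ Λᶜ, (if x j = y j then (0 : ℝ) else 1) = 0 :=
      Finset.sum_eq_zero fun j hj => if_pos (hsupp x hx j (Finset.mem_compl.1 hj))
    simp [hfix x (hsupp x hx), hx.ne', h0]
  · intro x hx
    have hnonneg : ∀ j ∈ Λᶜ, 0 ≤ (if x j = y j then (0 : ℝ) else 1) := by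
      intro j _
      split_ifs <;> norm_num
    simp only [Pi.add_apply, Finset.sum_apply]
    by_cases hc : ∀ j ∉ Λ, x j = y j
    · rw [hfix x hc, if_pos hx]
      linarith [Finset.sum_nonneg hnonneg]
    · push Not at hc
      obtain ⟨j, hj, hne⟩ := hc
      have h1 := Finset.single_le_sum hnonneg (Finset.mem_compl.2 hj)
      rw [if_neg hne] at h1
      have h2 : (0 : ℝ) ≤ if p (r x) = 0 then 1 else 0 := by split_ifs <;> norm_num
      linarith

open Classical in
/-- Neighborliness: any function on the subcube through `z` with free coordinates `T` is majorized
by a `k`-interaction function that touches it exactly at a prescribed set of fewer than `2 ^ k`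
points. -/
lemma exists_interaction_majorant_on (T : Finset (Fin N)) :
    ∀ (k : ℕ) (z : (i : Fin N) → X i) (S : Finset ((i : Fin N) → X i))
      (f : ((i : Fin N) → X i) → ℝ), S.card < 2 ^ k →
      ∃ h ∈ interactionSpace k X, ∀ x, (∀ i ∉ T, x i = z i) →
        (x ∈ S → h x = f x) ∧ (x ∉ S → f x < h x) := by
  induction T using Finset.induction_on with
  | empty =>
    intro k z S f _
    refine ⟨fun _ => if z ∈ S then f z else f z + 1, const_mem_interactionSpace _ _,
      fun x hx => ?_⟩
    obtain rfl : x = z := funext fun i => hx i (by simp)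
    constructor <;> intro h <;> simp [h]
  | insert i T hi ih =>
    intro k z S f hS
    rcases k with _ | k
    · obtain rfl : S = ∅ := by simpa using hS
      refine ⟨fun _ => ∑ y, |f y| + 1, const_mem_interactionSpace _ _, fun x _ => ?_⟩
      have h1 := Finset.single_le_sum (f := fun y => |f y|) (fun y _ => abs_nonneg _)
        (Finset.mem_univ x)
      simp only [Finset.notMem_empty, false_implies, not_false_eq_true, true_implies, true_and]
      linarith [le_abs_self (f x)]
    · let slice : X i → Finset ((i : Fin N) → X i) := fun b => S.filter fun x => x i = b
      obtain ⟨a, -, ha⟩ := Finset.exists_max_image Finset.univ (fun b => (slice b).card)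
        ⟨z i, Finset.mem_univ _⟩
      have hsmall : ∀ b, b ≠ a → (slice b).card < 2 ^ k := by
        intro b hb
        have hle := ha b (Finset.mem_univ b)
        have hdisj : Disjoint (slice b) (slice a) :=
          Finset.disjoint_filter.2 fun x _ h1 h2 => hb (h1.symm.trans h2)
        have hunion : (slice b ∪ slice a).card ≤ S.card :=
          Finset.card_le_card (Finset.union_subset (Finset.filter_subset _ _)
            (Finset.filter_subset _ _))
        rw [Finset.card_union_of_disjoint hdisj] at hunion
        rw [pow_succ] at hS
        omega
      obtain ⟨h₀, hh₀, hh₀'⟩ := ih (k + 1) (Function.update z i a) (slice a) f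
        ((Finset.card_le_card (Finset.filter_subset _ _)).trans_lt hS)
      have hex : ∀ b, ∃ h ∈ interactionSpace k X, b ≠ a → ∀ x,
          (∀ j ∉ T, x j = Function.update z i b j) →
          (x ∈ slice b → h x = f x - h₀ x) ∧ (x ∉ slice b → f x - h₀ x < h x) := by
        intro b
        by_cases hb : b = a
        · exact ⟨0, Submodule.zero_mem _, fun h => absurd hb h⟩
        · obtain ⟨h, hh, hh'⟩ := ih k (Function.update z i b) (slice b) (fun x => f x - h₀ x)
            (hsmall b hb)
          exact ⟨h, hh, fun _ => hh'⟩
      choose H hH hH' using hex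
      refine ⟨h₀ + ∑ b ∈ Finset.univ.erase a, fun x => (if x i = b then 1 else 0) * H b x,
        Submodule.add_mem _ hh₀ (Submodule.sum_mem _ fun b _ =>
          mul_coord_mem_interactionSpace (hH b) i fun c => if c = b then 1 else 0), ?_⟩
      intro x hx
      have hx' : ∀ j ∉ T, x j = Function.update z i (x i) j := by
        intro j hj
        by_cases hji : j = i
        · subst hji; simp
        · rw [Function.update_of_ne hji]
          exact hx j (by simp [hji, hj])
      have hmem : x ∈ slice (x i) ↔ x ∈ S := by simp [slice]
      simp only [Pi.add_apply, Finset.sum_apply, ite_mul, one_mul, zero_mul, Finset.sum_ite_eq,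
        Finset.mem_erase, Finset.mem_univ, and_true]
      by_cases hxa : x i = a
      · have := hh₀' x (hxa ▸ hx')
        rw [← hxa, hmem] at this
        simpa [hxa] using this
      · have := hH' (x i) hxa x hx'
        rw [hmem] at this
        simp only [ne_eq, hxa, not_false_eq_true, if_true]
        exact ⟨fun h => by linarith [this.1 h], fun h => by linarith [this.2 h]⟩

/-- A distribution whose support has fewer than `2 ^ k` elements is in the closure of the
`k`-interaction family. -/
lemma mem_closure_of_card_support_lt {k : ℕ} {p : ((i : Fin N) → X i) → ℝ} (hp : IsDist p)
    (hcard : {x | 0 < p x}.ncard < 2 ^ k) :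
    p ∈ closure (interactionFamily k) := by
  classical
  have hne : Nonempty ((i : Fin N) → X i) := by
    by_contra hemp
    rw [not_nonempty_iff] at hemp
    simpa using hp.2
  obtain ⟨z⟩ := hne
  have hcard' : (Finset.univ.filter fun x => 0 < p x).card < 2 ^ k := by
    rwa [← Set.ncard_coe_finset, Finset.coe_filter_univ]
  obtain ⟨h₁, hh₁, hh₁'⟩ := exists_interaction_majorant_on Finset.univ k z _
    (fun x => Real.log (p x)) hcard'
  obtain ⟨h₂, hh₂, hh₂'⟩ := exists_interaction_majorant_on Finset.univ k z _
    (fun _ => 0) hcard'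
  refine mem_closure_interactionFamily hp hh₁ hh₂ (fun x hx => ?_) (fun x hx => ?_) fun x hx => ?_
  · exact (hh₁' x (by simp)).1 (by simpa using hx)
  · exact (hh₂' x (by simp)).1 (by simpa using hx)
  · exact (hh₂' x (by simp)).2 (by simp [hx])

end InteractionSpace

open Classical in
/-- If the support of `p` is covered by sets `A i` such that `C` contains all distributions
supported in some `A i`, then `p` is a convex combination of elements of `C`, one for each `i`. -/
lemma exists_convex_combination_of_cover {Y : Type*} [Fintype Y] {m : ℕ} {p : Y → ℝ}
    (hp : IsDist p) {C : Set (Y → ℝ)} (hC : C.Nonempty) (A : Fin m → Set Y)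
    (hA : ∀ x, 0 < p x → ∃ i, x ∈ A i)
    (hAC : ∀ i q, IsDist q → (∀ x, 0 < q x → x ∈ A i) → q ∈ C) :
    ∃ (α : Fin m → ℝ) (f : Fin m → Y → ℝ),
      (∀ i, 0 ≤ α i) ∧ ∑ i, α i = 1 ∧ (∀ i, f i ∈ C) ∧ ∀ x, p x = ∑ i, α i * f i x := by
  obtain ⟨q₀, hq₀⟩ := hC
  obtain ⟨x₀, hx₀⟩ : ∃ x, 0 < p x := by
    by_contra! h
    linarith [hp.2, Finset.sum_nonpos fun x (_ : x ∈ Finset.univ) => h x]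
  obtain ⟨i₀, -⟩ := hA x₀ hx₀
  let c : Y → Fin m := fun x => if h : 0 < p x then (hA x h).choose else i₀
  have hc : ∀ x, 0 < p x → x ∈ A (c x) := by
    intro x hx
    simp only [c, dif_pos hx]
    exact (hA x hx).choose_spec
  let w : Fin m → Y → ℝ := fun i x => if c x = i then p x else 0
  have hw : ∀ i x, 0 ≤ w i x := by
    intro i x
    simp only [w]
    split_ifs
    exacts [hp.1 x, le_rfl]
  have hwsum : ∀ x, ∑ i, w i x = p x := fun x => by simp [w]
  refine ⟨fun i => ∑ x, w i x,
    fun i => if ∑ x, w i x = 0 then q₀ else fun x => w i x / ∑ y, w i y,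
    fun i => Finset.sum_nonneg fun x _ => hw i x, ?_, fun i => ?_, fun x => ?_⟩
  · rw [Finset.sum_comm]
    simp only [hwsum, hp.2]
  · simp only
    split_ifs with h
    · exact hq₀
    · refine hAC i _ ⟨fun x => div_nonneg (hw i x) (Finset.sum_nonneg fun y _ => hw i y), ?_⟩
        fun x hx => ?_
      · rw [← Finset.sum_div, div_self h]
      · have hcx : c x = i := by
          by_contra hne
          simp [w, hne] at hx
        have hpx : p x ≠ 0 := by
          intro h0
          simp [w, h0] at hx
        exact hcx ▸ hc x ((hp.1 x).lt_of_ne' hpx)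
  · rw [← hwsum x]
    refine Finset.sum_congr rfl fun i _ => ?_
    dsimp only
    split_ifs with h
    · rw [h, zero_mul]
      exact (Finset.sum_eq_zero_iff_of_nonneg fun y _ => hw i y).1 h x (Finset.mem_univ x)
    · field_simp

/-- A finite set with at most `m * d` elements is covered by `m` sets with at most `d` elements. -/
lemma Set.Finite.exists_cover_ncard_le {Y : Type*} {s : Set Y} (hs : s.Finite) {m d : ℕ}
    (h : s.ncard ≤ m * d) :
    ∃ A : Fin m → Set Y, (∀ x ∈ s, ∃ i, x ∈ A i) ∧ ∀ i, (A i).Finite ∧ (A i).ncard ≤ d := by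
  have := hs.fintype
  obtain ⟨e⟩ : Nonempty (s ↪ Fin m × Fin d) := by
    apply Function.Embedding.nonempty_of_card_le
    rw [Fintype.card_prod, Fintype.card_fin, Fintype.card_fin, ← Nat.card_eq_fintype_card]
    exact h
  refine ⟨fun i => (fun x : s => (x : Y)) '' {x | (e x).1 = i},
    fun x hx => ⟨(e ⟨x, hx⟩).1, ⟨x, hx⟩, rfl, rfl⟩, fun i => ⟨Set.toFinite _, ?_⟩⟩
  refine (Set.ncard_image_le (Set.toFinite _)).trans ?_
  rw [← Nat.card_coe_set_eq, Nat.card_eq_fintype_card]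
  conv_rhs => rw [← Fintype.card_fin d]
  refine Fintype.card_le_of_injective (fun x : {x | (e x).1 = i} => (e x).2) fun x y hxy => ?_
  exact Subtype.ext (e.injective (Prod.ext (x.2.trans y.2.symm) hxy))

/-- if `supp p` is covered by `m` cylinder sets of dimension `k`,
or `m(2^k - 1) ≥ |supp p|`, then `p` is a convex combination of `m` elements of
the closure of the `k`-interaction exponential family. -/
theorem stmt_17 (N k m : ℕ) (X : Fin N → Type*) [∀ i, Fintype (X i)]
    (hk1 : 1 ≤ k) (hkN : k ≤ N)
    (p : ((i : Fin N) → X i) → ℝ) (hp : IsDist p)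
    (hcov : (∃ (Λ : Fin m → Finset (Fin N)) (y : Fin m → (i : Fin N) → X i),
        (∀ i, (Λ i).card = k) ∧
        ∀ x, 0 < p x → ∃ i, ∀ j ∉ Λ i, x j = y i j) ∨
      {x | 0 < p x}.ncard ≤ m * (2 ^ k - 1)) :
    ∃ (α : Fin m → ℝ) (f : Fin m → ((i : Fin N) → X i) → ℝ),
      (∀ i, 0 ≤ α i) ∧ ∑ i, α i = 1 ∧
      (∀ i, f i ∈ closure (interactionFamily k)) ∧
      ∀ x, p x = ∑ i, α i * f i x := by
  have hne : (closure (interactionFamily k (X := X))).Nonempty :=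
    ⟨_, subset_closure (exp_div_mem_interactionFamily (const_mem_interactionSpace k 0))⟩
  rcases hcov with ⟨Λ, y, hΛ, hcov⟩ | hcard
  · exact exists_convex_combination_of_cover hp hne (fun i => {x | ∀ j ∉ Λ i, x j = y i j}) hcov
      fun i q hq hsupp => mem_closure_of_support_subset_cylinder hk1 hq (hΛ i).le hsupp
  · obtain ⟨A, hA, hAcard⟩ := (Set.toFinite _).exists_cover_ncard_le hcard
    refine exists_convex_combination_of_cover hp hne A hA fun i q hq hsupp =>
      mem_closure_of_card_support_lt hq ?_
    have h1 := (Set.ncard_le_ncard hsupp (hAcard i).1).trans (hAcard i).2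
    exact h1.trans_lt (Nat.sub_lt (by positivity) one_pos)
end

section
/- Let N ≥ 2 and 1 ≤ j ≤ N−1. Suppose m is such that every element of the j-interaction exponential family E^j on {0,1}^N can be written as a convex combination of m product distributions on {0,1}^N. Then m ≥ 2^j − 1, and m·(N+1) ≥ 1 + ∑_{i=1}^j binom(N, i). -/
/-- A product distribution on `X = X_1 × ⋯ × X_N`. -/
def IsProductDist {N : ℕ} {X : Fin N → Type*} [∀ i, Fintype (X i)]
    (p : ((i : Fin N) → X i) → ℝ) : Prop :=
  ∃ f : (i : Fin N) → X i → ℝ, (∀ i, IsDist (f i)) ∧ ∀ x, p x = ∏ i, f i (x i)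

/-- The `k`-interaction exponential family on `{0,1}^N`. -/
abbrev EkBin (N k : ℕ) : Set ((Fin N → Fin 2) → ℝ) := interactionFamily k

/-- The point of `{0,1}^N` with support `s`. -/
def indicatorPoint {N : ℕ} (s : Finset (Fin N)) : Fin N → Fin 2 :=
  fun i => if i ∈ s then 1 else 0

/-- The linear map sending coefficients `y` to the function `x ↦ ∑ s, y s * ∏ i ∈ s, x i`. -/
def monomialSum (N : ℕ) : (Finset (Fin N) → ℝ) →ₗ[ℝ] ((Fin N → Fin 2) → ℝ) where
  toFun y x := ∑ s, y s * ∏ i ∈ s, ((x i : ℕ) : ℝ)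
  map_add' y z := by
    ext x
    simp [add_mul, Finset.sum_add_distrib]
  map_smul' c y := by
    ext x
    simp [Finset.mul_sum, mul_assoc]

theorem monomialSum_apply {N : ℕ} (y : Finset (Fin N) → ℝ) (x : Fin N → Fin 2) :
    monomialSum N y x = ∑ s, y s * ∏ i ∈ s, ((x i : ℕ) : ℝ) := rfl

theorem monomialSum_indicatorPoint {N : ℕ} (y : Finset (Fin N) → ℝ) (s : Finset (Fin N)) :
    monomialSum N y (indicatorPoint s) = ∑ t ∈ s.powerset, y t := by
  have key (t : Finset (Fin N)) :
      ∏ i ∈ t, ((indicatorPoint s i : ℕ) : ℝ) = if t ∈ s.powerset then 1 else 0 := by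
    simp only [Finset.mem_powerset]
    split_ifs with h
    · exact Finset.prod_eq_one fun i hi => by simp [indicatorPoint, h hi]
    · obtain ⟨i, hi, his⟩ := Finset.not_subset.mp h
      exact Finset.prod_eq_zero hi (by simp [indicatorPoint, his])
  simp only [monomialSum_apply, key, mul_ite, mul_one, mul_zero, Finset.sum_ite_mem,
    Finset.univ_inter]

theorem monomialSum_injective (N : ℕ) : Function.Injective (monomialSum N) := by
  rw [← LinearMap.ker_eq_bot, LinearMap.ker_eq_bot']
  intro y hy
  ext s
  induction s using Finset.strongInduction with
  | H s ih =>
    have h := monomialSum_indicatorPoint y s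
    rw [hy, Finset.sum_eq_single s] at h
    · simpa using h.symm
    · intro t ht hts
      exact ih t ((Finset.mem_powerset.mp ht).ssubset_of_ne hts)
    · simp

theorem exp_monomialSum_mem_EkBin {N j : ℕ} {y : Finset (Fin N) → ℝ}
    (hy : ∀ s, j < s.card → y s = 0) :
    (fun x => Real.exp (monomialSum N y x) / ∑ z, Real.exp (monomialSum N y z)) ∈ EkBin N j := by
  refine ⟨fun s x => y s * ∏ i ∈ s, ((x i : ℕ) : ℝ), ?_, ?_, fun x => rfl⟩
  · intro s x z h
    simp only
    rw [Finset.prod_congr rfl fun i hi => by rw [h i hi]]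
  · intro s hs
    ext x
    simp [hy s hs]

/-- `p` is a nonnegative combination of `m` product distributions. -/
def IsProductCombination {N : ℕ} (m : ℕ) (p : (Fin N → Fin 2) → ℝ) : Prop :=
  ∃ (c : Fin m → ℝ) (q : Fin m → Fin N → Fin 2 → ℝ),
    (∀ i, 0 ≤ c i) ∧ (∀ i k, IsDist (q i k)) ∧ ∀ x, p x = ∑ i, c i * ∏ k, q i k (x k)

theorem IsProductCombination.of_normalized {N m : ℕ} {p : (Fin N → Fin 2) → ℝ} {Z : ℝ}
    (hZ : 0 < Z)
    (h : ∃ (α : Fin m → ℝ) (f : Fin m → (Fin N → Fin 2) → ℝ),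
      (∀ i, 0 ≤ α i) ∧ ∑ i, α i = 1 ∧ (∀ i, IsProductDist (f i)) ∧
      ∀ x, p x / Z = ∑ i, α i * f i x) :
    IsProductCombination m p := by
  obtain ⟨α, f, hα, -, hf, hp⟩ := h
  choose q hq hfq using hf
  refine ⟨fun i => Z * α i, q, fun i => mul_nonneg hZ.le (hα i), hq, fun x => ?_⟩
  rw [← mul_div_cancel₀ (p x) hZ.ne', hp x, Finset.mul_sum]
  exact Finset.sum_congr rfl fun i _ => by rw [hfq, mul_assoc]

theorem prod_indicatorPoint_mul_exchange {N : ℕ} (q : Fin N → Fin 2 → ℝ)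
    {s t : Finset (Fin N)} {a : Fin N} (has : a ∈ s) (hat : a ∉ t) :
    (∏ k, q k (indicatorPoint s k)) * ∏ k, q k (indicatorPoint t k) =
      (∏ k, q k (indicatorPoint (s.erase a) k)) * ∏ k, q k (indicatorPoint (insert a t) k) := by
  rw [← Finset.prod_mul_distrib, ← Finset.prod_mul_distrib]
  refine Finset.prod_congr rfl fun k _ => ?_
  by_cases hk : k = a
  · subst hk
    simp [indicatorPoint, has, hat, mul_comm]
  · simp [indicatorPoint, hk]

theorem card_filter_even_powerset {ι : Type*} {J : Finset ι} {j : ℕ}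
    (hJ : J.card = j + 1) : (J.powerset.filter fun s => Even s.card).card = 2 ^ j := by
  have h₁ := Finset.card_filter_add_card_filter_not (s := J.powerset) fun s => Even s.card
  have h₂ := Finset.sum_powerset_neg_one_pow_card_of_nonempty
    (Finset.card_pos.mp (by omega : 0 < J.card))
  rw [← Finset.sum_filter_add_sum_filter_not _ fun s => Even s.card,
    Finset.sum_congr rfl fun s hs => (Finset.mem_filter.mp hs).2.neg_one_pow,
    Finset.sum_congr (g := fun _ => -1) rfl fun s hs =>
      (Nat.not_even_iff_odd.mp (Finset.mem_filter.mp hs).2).neg_one_pow] at h₂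
  simp only [Finset.sum_const, nsmul_eq_mul] at h₂
  rw [Finset.card_powerset, hJ, pow_succ] at h₁
  omega

/-- Coefficients of the polynomial of degree less than `#J` which, at the indicator of `s ⊆ J`,
equals `-1` if `#s` is odd, `0` if `#s` is even and positive, and `-2 ^ (#J - 1)` if `s = ∅`. -/
noncomputable def parityCoeff {ι : Type*} [DecidableEq ι] (J : Finset ι) (s : Finset ι) : ℝ :=
  if s ⊆ J then
    (-2) ^ s.card / 2 - 2 ^ (J.card - 1) * (-1) ^ s.card - (if s = ∅ then 1 / 2 else 0)
  else 0

theorem parityCoeff_eq_zero {ι : Type*} [DecidableEq ι] {J s : Finset ι} {j : ℕ}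
    (hJ : J.card = j + 1) (hs : j < s.card) : parityCoeff J s = 0 := by
  unfold parityCoeff
  split_ifs with h h0
  · simp [h0] at hs
  · have : s.card = j + 1 := le_antisymm (hJ ▸ Finset.card_le_card h) hs
    rw [this, hJ, Nat.add_sub_cancel, neg_pow 2 (j + 1)]
    ring
  · rfl

theorem sum_powerset_parityCoeff {ι : Type*} [DecidableEq ι] {J s : Finset ι} (hs : s ⊆ J)
    (hne : s.Nonempty) : ∑ t ∈ s.powerset, parityCoeff J t = ((-1) ^ s.card - 1) / 2 := by
  have hsum (a : ℝ) : ∑ t ∈ s.powerset, a ^ t.card = (a + 1) ^ s.card := by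
    simpa using Finset.sum_pow_mul_eq_add_pow a 1 s
  unfold parityCoeff
  rw [Finset.sum_congr rfl fun t ht => if_pos ((Finset.mem_powerset.mp ht).trans hs),
    Finset.sum_sub_distrib, Finset.sum_sub_distrib, ← Finset.sum_div, ← Finset.mul_sum,
    hsum, hsum, Finset.sum_ite_eq' s.powerset ∅, if_pos (Finset.empty_mem_powerset s)]
  norm_num [hne.ne_empty]
  ring

theorem IsProductCombination.card_le {N m : ℕ} {p : (Fin N → Fin 2) → ℝ}
    (hp : IsProductCombination m p) {S : Finset (Finset (Fin N))} {ε : ℝ}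
    (hε : m * ε < 1) (hS : ∀ s ∈ S, p (indicatorPoint s) = 1)
    (herase : ∀ s ∈ S, ∀ t ∈ S, ∀ a ∈ s, a ∉ t → p (indicatorPoint (s.erase a)) ≤ ε)
    (hinsert : ∀ s ∈ S, ∀ t ∈ S, ∀ a ∈ s, a ∉ t → p (indicatorPoint (insert a t)) ≤ ε) :
    S.card ≤ m := by
  obtain ⟨c, q, hc, hq, hpq⟩ := hp
  have hterm (i : Fin m) (x : Fin N → Fin 2) : 0 ≤ c i * ∏ k, q i k (x k) :=
    mul_nonneg (hc i) (Finset.prod_nonneg fun k _ => (hq i k).1 _)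
  have hterm_le (i : Fin m) (x : Fin N → Fin 2) : c i * ∏ k, q i k (x k) ≤ p x := by
    rw [hpq x]
    exact Finset.single_le_sum (f := fun i => c i * ∏ k, q i k (x k))
      (fun i _ => hterm i x) (Finset.mem_univ i)
  have hlarge : ∀ s ∈ S, ∃ i, 1 ≤ m * (c i * ∏ k, q i k (indicatorPoint s k)) := by
    intro s hs
    by_contra! h
    have h1 := hS s hs
    rw [hpq] at h1
    have hm : (Finset.univ : Finset (Fin m)).Nonempty := by
      by_contra hne
      simp [Finset.not_nonempty_iff_eq_empty.mp hne] at h1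
    have h2 := Finset.sum_lt_sum_of_nonempty hm fun i _ => h i
    rw [← Finset.mul_sum, h1] at h2
    simp at h2
  rcases S.eq_empty_or_nonempty with rfl | ⟨s₀, hs₀⟩
  · simp
  have : Nonempty (Fin m) := ⟨(hlarge s₀ hs₀).choose⟩
  choose! i hi using hlarge
  have hdisj : ∀ s ∈ S, ∀ t ∈ S, i s = i t → ∀ a ∈ s, a ∈ t := by
    intro s hs t ht hst a has
    by_contra hat
    have h1 := hi s hs
    have h2 := hi t ht
    rw [← hst] at h2
    have hex := prod_indicatorPoint_mul_exchange (q (i s)) has hat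
    have h3 := (hterm_le (i s) (indicatorPoint (s.erase a))).trans (herase s hs t ht a has hat)
    have h4 := (hterm_le (i s) (indicatorPoint (insert a t))).trans (hinsert s hs t ht a has hat)
    have h5 := mul_le_mul h3 h4 (hterm _ _) ((hterm _ _).trans h3)
    have h6 := mul_le_mul h1 h2 zero_le_one (zero_le_one.trans h1)
    have h7 : (m : ℝ) * (c (i s) * ∏ k, q (i s) k (indicatorPoint s k)) *
        (m * (c (i s) * ∏ k, q (i s) k (indicatorPoint t k))) =
        m ^ 2 * ((c (i s) * ∏ k, q (i s) k (indicatorPoint (s.erase a) k)) *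
          (c (i s) * ∏ k, q (i s) k (indicatorPoint (insert a t) k))) := by
      linear_combination (m : ℝ) ^ 2 * c (i s) ^ 2 * hex
    have h8 : (1 : ℝ) ≤ (m * ε) ^ 2 := by
      calc (1 : ℝ) ≤ _ := by simpa using h6
        _ = _ := h7
        _ ≤ m ^ 2 * (ε * ε) := by gcongr
        _ = (m * ε) ^ 2 := by ring
    have h9 : 0 ≤ m * ε := mul_nonneg (Nat.cast_nonneg m) ((hterm _ _).trans h3)
    nlinarith
  simpa using Finset.card_le_card_of_injOn i (t := Finset.univ) (by simp) fun s hs t ht h =>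
    Finset.Subset.antisymm (hdisj s hs t ht h) (hdisj t ht s hs h.symm)

theorem two_pow_sub_one_le_of_isProductCombination {N j m : ℕ} (hjN : j + 1 ≤ N)
    (h : ∀ y : Finset (Fin N) → ℝ, (∀ s, j < s.card → y s = 0) →
      IsProductCombination m fun x => Real.exp (monomialSum N y x)) :
    2 ^ j - 1 ≤ m := by
  obtain ⟨J, -, hJ⟩ := Finset.exists_subset_card_eq (s := (Finset.univ : Finset (Fin N)))
    (n := j + 1) (by simpa using hjN)
  have hcard := card_filter_even_powerset hJ
  have hp := h ((m : ℝ) • parityCoeff J) fun s hs => by simp [parityCoeff_eq_zero hJ hs]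
  have hval {s : Finset (Fin N)} (hs : s ⊆ J) (hne : s.Nonempty) :
      Real.exp (monomialSum N ((m : ℝ) • parityCoeff J) (indicatorPoint s)) =
        Real.exp (m * (((-1) ^ s.card - 1) / 2)) := by
    rw [map_smul, Pi.smul_apply, monomialSum_indicatorPoint, sum_powerset_parityCoeff hs hne,
      smul_eq_mul]
  have hodd {s : Finset (Fin N)} (hs : s ⊆ J) (hs' : Odd s.card) :
      Real.exp (monomialSum N ((m : ℝ) • parityCoeff J) (indicatorPoint s)) ≤
        Real.exp (-m) := by
    rw [hval hs (Finset.card_pos.mp hs'.pos), hs'.neg_one_pow]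
    norm_num
  have hS : ((J.powerset.filter fun s => Even s.card).erase ∅).card = 2 ^ j - 1 := by
    rw [Finset.card_erase_of_mem (by simp), hcard]
  rw [← hS]
  refine hp.card_le (ε := Real.exp (-m)) ?_ ?_ ?_ ?_
  · rw [Real.exp_neg, ← div_eq_mul_inv, div_lt_one (Real.exp_pos _)]
    linarith [Real.add_one_le_exp (m : ℝ)]
  all_goals simp only [Finset.mem_erase, Finset.mem_filter, Finset.mem_powerset]
  · rintro s ⟨hne, hs, he⟩
    rw [hval hs (Finset.nonempty_iff_ne_empty.mpr hne), he.neg_one_pow]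
    simp
  · rintro s ⟨-, hs, he⟩ t - a has -
    refine hodd ((Finset.erase_subset a s).trans hs) ?_
    rw [← Finset.card_erase_add_one has] at he
    exact Nat.not_even_iff_odd.mp fun h => by simp [Nat.even_add_one, h] at he
  · rintro s ⟨-, hs, -⟩ t ⟨-, ht, he⟩ a has hat
    refine hodd (Finset.insert_subset (hs has) ht) ?_
    rw [Finset.card_insert_of_notMem hat]
    exact he.add_one

theorem finrank_le_finrank_of_contDiffAt_image_eq_univ {E F : Type*} [NormedAddCommGroup E]
    [NormedSpace ℝ E] [FiniteDimensional ℝ E] [NormedAddCommGroup F] [NormedSpace ℝ F]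
    [FiniteDimensional ℝ F] {g : E → F} {s : Set E} (hg : ∀ x ∈ s, ContDiffAt ℝ 1 g x)
    (hs : g '' s = Set.univ) : Module.finrank ℝ F ≤ Module.finrank ℝ E := by
  have h : dimH (g '' s) ≤ dimH s := dimH_image_le_of_locally_lipschitzOn fun x hx => by
    obtain ⟨K, t, ht, hK⟩ := (hg x hx).exists_lipschitzOnWith
    exact ⟨K, t, mem_nhdsWithin_of_mem_nhds ht, hK⟩
  rw [hs, Real.dimH_univ_eq_finrank] at h
  have h' := h.trans (dimH_mono (Set.subset_univ s))
  rw [Real.dimH_univ_eq_finrank] at h'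
  exact_mod_cast h'

/-- The combination of `m` product functions with weights `θ.1` and success parameters `θ.2`. -/
def productMixture {N m : ℕ} (θ : (Fin m → ℝ) × (Fin m → Fin N → ℝ)) (x : Fin N → Fin 2) : ℝ :=
  ∑ i, θ.1 i * ∏ k, if x k = 1 then θ.2 i k else 1 - θ.2 i k

theorem contDiff_productMixture {N m : ℕ} (x : Fin N → Fin 2) :
    ContDiff ℝ 1 fun θ : (Fin m → ℝ) × (Fin m → Fin N → ℝ) => productMixture θ x := by
  unfold productMixture
  refine ContDiff.sum fun i _ => ContDiff.mul (by fun_prop) (contDiff_prod fun k _ => ?_)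
  split_ifs <;> fun_prop

theorem IsProductCombination.exists_productMixture {N m : ℕ} {p : (Fin N → Fin 2) → ℝ}
    (hp : IsProductCombination m p) :
    ∃ θ : (Fin m → ℝ) × (Fin m → Fin N → ℝ), ∀ x, productMixture θ x = p x := by
  obtain ⟨c, q, -, hq, hpq⟩ := hp
  refine ⟨(c, fun i k => q i k 1), fun x => ?_⟩
  rw [hpq, productMixture]
  refine Finset.sum_congr rfl fun i _ => congrArg _ (Finset.prod_congr rfl fun k _ => ?_)
  have h := (hq i k).2
  rw [Fin.sum_univ_two] at h
  split_ifs with hx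
  · rw [hx]
  · rw [show x k = 0 by omega]
    linarith

theorem card_subtype_card_le (N j : ℕ) :
    Fintype.card {s : Finset (Fin N) // s.card ≤ j} = 1 + ∑ i ∈ Finset.Icc 1 j, N.choose i := by
  have hset : (Finset.univ.filter fun s : Finset (Fin N) => s.card ≤ j) =
      (Finset.range (j + 1)).biUnion fun i => Finset.powersetCard i Finset.univ := by
    ext s
    simp
  rw [Fintype.card_subtype, hset, Finset.card_biUnion]
  · simp only [Finset.card_powersetCard, Finset.card_univ, Fintype.card_fin]
    rw [Finset.sum_range_succ', Nat.choose_zero_right, add_comm, Finset.range_eq_Ico,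
      Finset.sum_Ico_add' (fun i => N.choose i) 0 j 1]
    rfl
  · intro i _ k _ hik
    exact Finset.pairwise_disjoint_powersetCard _ hik

theorem card_le_of_isProductCombination {N j m : ℕ}
    (h : ∀ y : Finset (Fin N) → ℝ, (∀ s, j < s.card → y s = 0) →
      IsProductCombination m fun x => Real.exp (monomialSum N y x)) :
    1 + ∑ i ∈ Finset.Icc 1 j, N.choose i ≤ m * (N + 1) := by
  obtain ⟨L, hL⟩ := (monomialSum N).exists_leftInverse_of_injective
    (LinearMap.ker_eq_bot.mpr (monomialSum_injective N))
  let R : (Finset (Fin N) → ℝ) →ₗ[ℝ] ({s : Finset (Fin N) // s.card ≤ j} → ℝ) :=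
    LinearMap.funLeft ℝ ℝ Subtype.val
  let g (θ : (Fin m → ℝ) × (Fin m → Fin N → ℝ)) : {s : Finset (Fin N) // s.card ≤ j} → ℝ :=
    (R ∘ₗ L).toContinuousLinearMap fun x => Real.log (productMixture θ x)
  have hfin := finrank_le_finrank_of_contDiffAt_image_eq_univ (g := g)
    (s := {θ | ∀ x, productMixture θ x ≠ 0}) ?_ ?_
  · simp only [Module.finrank_prod, Module.finrank_pi_fintype, Module.finrank_self,
      Finset.sum_const, Finset.card_univ, Fintype.card_fin, smul_eq_mul, mul_one,
      card_subtype_card_le] at hfin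
    linarith
  · intro θ hθ
    exact (ContinuousLinearMap.contDiff _).contDiffAt.comp θ
      (contDiffAt_pi.mpr fun x => (contDiff_productMixture x).contDiffAt.log (hθ x))
  · refine Set.eq_univ_of_forall fun y => ?_
    let y' (s : Finset (Fin N)) : ℝ := if hs : s.card ≤ j then y ⟨s, hs⟩ else 0
    obtain ⟨θ, hθ⟩ := (h y' fun s hs => dif_neg hs.not_ge).exists_productMixture
    refine ⟨θ, fun x => hθ x ▸ (Real.exp_pos _).ne', ?_⟩
    have hlog : (fun x => Real.log (productMixture θ x)) = monomialSum N y' := by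
      ext x
      rw [hθ, Real.log_exp]
    have hLy : L (monomialSum N y') = y' := LinearMap.congr_fun hL y'
    ext s
    simp [g, R, hlog, hLy, y', s.2]

/-- if every element of `E^j` on `{0,1}^N` is a convex
combination of `m` product distributions, then `m ≥ 2^j - 1` and
`m(N+1) ≥ 1 + ∑_{i=1}^j C(N,i)`. -/
theorem stmt_18 (N j m : ℕ) (hN : 2 ≤ N) (hj1 : 1 ≤ j) (hjN : j ≤ N - 1)
    (hmix : ∀ p ∈ EkBin N j,
      ∃ (α : Fin m → ℝ) (f : Fin m → (Fin N → Fin 2) → ℝ),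
        (∀ i, 0 ≤ α i) ∧ ∑ i, α i = 1 ∧ (∀ i, IsProductDist (f i)) ∧
        ∀ x, p x = ∑ i, α i * f i x) :
    2 ^ j - 1 ≤ m ∧ 1 + ∑ i ∈ Finset.Icc 1 j, N.choose i ≤ m * (N + 1) := by
  have h (y : Finset (Fin N) → ℝ) (hy : ∀ s, j < s.card → y s = 0) :
      IsProductCombination m fun x => Real.exp (monomialSum N y x) :=
    .of_normalized (Finset.sum_pos (fun _ _ => Real.exp_pos _) Finset.univ_nonempty)
      (hmix _ (exp_monomialSum_mem_EkBin hy))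
  exact ⟨two_pow_sub_one_le_of_isProductCombination (by omega) h,
    card_le_of_isProductCombination h⟩
end

section
/- Let A : {0,1,2,3,4} → ℝ² be such that the points A_0,…,A_4 are pairwise distinct, the convex hull Q = conv{A_0,…,A_4} has exactly the five points A_0,…,A_4 as extreme points, and for each i ∈ {0,…,4} the segment conv{A_i, A_{(i+1) mod 5}} is an exposed face of Q (so Q is a pentagon whose boundary is the polyline A_0A_1A_2A_3A_4A_0). Let E be the exponential family of distributions p_θ(x) = exp(⟨θ, A(x)⟩)/∑_{y=0}^{4} exp(⟨θ, A(y)⟩) for θ ∈ ℝ². Then every strictly positive probability distribution on the 5-element set {0,1,2,3,4} is a convex combination of 2 elements of E. -/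
/-- The exponential family on `X` with sufficient statistics `A : X → ℝ^d`. -/
def expFam {X : Type*} [Fintype X] {d : ℕ} (A : X → Fin d → ℝ) :
    Set (X → ℝ) :=
  {p | ∃ θ : Fin d → ℝ, ∀ x, p x =
    Real.exp (∑ j, θ j * A x j) / ∑ y, Real.exp (∑ j, θ j * A y j)}

open Filter Topology

/-- If the partial derivative in the first variable is onto, then the level set of `f` through
`(z₀, ε₀)` meets every nearby slice. -/
lemma HasStrictFDerivAt.eventually_exists_eq {E P G : Type*}
    [NormedAddCommGroup E] [NormedSpace ℝ E] [CompleteSpace E]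
    [NormedAddCommGroup P] [NormedSpace ℝ P] [CompleteSpace P]
    [NormedAddCommGroup G] [NormedSpace ℝ G] [CompleteSpace G]
    {f : E × P → G} {f' : E × P →L[ℝ] G} {z₀ : E} {ε₀ : P}
    (hf : HasStrictFDerivAt f f' (z₀, ε₀)) (hsurj : ∀ y, ∃ z, f' (z, 0) = y) :
    ∀ᶠ ε in 𝓝 ε₀, ∃ z, f (z, ε) = f (z₀, ε₀) := by
  have hF := hf.prodMk (hasStrictFDerivAt_snd (𝕜 := ℝ) (E := E) (F := P) (p := (z₀, ε₀)))
  have hmap := hF.map_nhds_eq_of_surj (by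
    rw [LinearMap.range_eq_top]
    rintro ⟨y, η⟩
    obtain ⟨z, hz⟩ := hsurj (y - f' (0, η))
    refine ⟨(z, η), ?_⟩
    have : f' (z, η) = f' (z, 0) + f' (0, η) := by rw [← map_add]; simp
    simp [this, hz])
  have hmem : Set.range (fun x : E × P => (f x, x.2)) ∈ 𝓝 (f (z₀, ε₀), ε₀) := by
    rw [← hmap]; exact Filter.range_mem_map
  have hc : Tendsto (fun ε : P => (f (z₀, ε₀), ε)) (𝓝 ε₀) (𝓝 (f (z₀, ε₀), ε₀)) :=
    (Continuous.prodMk_right _).tendsto ε₀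
  filter_upwards [hc hmem] with ε hε
  obtain ⟨⟨z, η⟩, h⟩ := hε
  simp only [Prod.mk.injEq] at h
  obtain ⟨h1, rfl⟩ := h
  exact ⟨z, h1⟩

/-- For large `t` the system is a small perturbation of `log (1 + exp s₀) = a`,
`log (1 + exp s₁) = b`, hence solvable. -/
lemma exists_softplus_eq_add_sum {κ : Type*} [Fintype κ] {a b : ℝ} (ha : 0 < a) (hb : 0 < b)
    (B C Q R d : κ → ℝ) (hd : ∀ k, 0 < d k) :
    ∃ t s₀ s₁ : ℝ,
      Real.log (1 + Real.exp s₀) =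
        a + ∑ k, B k * Real.log (1 + Real.exp (s₀ * Q k + s₁ * R k - t * d k)) ∧
      Real.log (1 + Real.exp s₁) =
        b + ∑ k, C k * Real.log (1 + Real.exp (s₀ * Q k + s₁ * R k - t * d k)) := by
  have hinv : ∀ y : ℝ, 0 < y → ∃ s, Real.log (1 + Real.exp s) = y := fun y hy =>
    ⟨Real.log (Real.exp y - 1), by
      rw [Real.exp_log (by simpa using hy)]; simp⟩
  obtain ⟨z₀, hz₀⟩ := hinv a ha
  obtain ⟨z₁, hz₁⟩ := hinv b hb
  let f : (ℝ × ℝ) × (κ → ℝ) → ℝ × ℝ := fun x =>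
    (Real.log (1 + Real.exp x.1.1) -
        ∑ k, B k * Real.log (1 + Real.exp (x.1.1 * Q k + x.1.2 * R k) * x.2 k),
      Real.log (1 + Real.exp x.1.2) -
        ∑ k, C k * Real.log (1 + Real.exp (x.1.1 * Q k + x.1.2 * R k) * x.2 k))
  have hf0 : f ((z₀, z₁), 0) = (a, b) := by simp [f, hz₀, hz₁]
  have hsp (s : ℝ) : 1 + Real.exp s ≠ 0 := by positivity
  have hfd : ContDiffAt ℝ 1 f ((z₀, z₁), 0) := by
    refine ContDiffAt.prodMk ?_ ?_ <;>
    · refine ContDiffAt.sub (ContDiffAt.log (by fun_prop) (hsp _)) ?_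
      refine ContDiffAt.sum fun k _ => contDiffAt_const.mul (ContDiffAt.log (by fun_prop) ?_)
      simp
  have hstrict := hfd.hasStrictFDerivAt one_ne_zero
  have hsurj : ∀ y : ℝ × ℝ, ∃ z, fderiv ℝ f ((z₀, z₁), 0) (z, 0) = y := by
    have hslice := HasFDerivAt.comp (𝕜 := ℝ) (g := f)
      (f := fun z : ℝ × ℝ => (z, (0 : κ → ℝ))) (z₀, z₁) hstrict.hasFDerivAt
      (hasFDerivAt_prodMk_left (z₀, z₁) (0 : κ → ℝ))
    have hcomp : (f ∘ fun z : ℝ × ℝ => (z, (0 : κ → ℝ))) =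
        fun z => (Real.log (1 + Real.exp z.1), Real.log (1 + Real.exp z.2)) := by
      ext z <;> simp [f]
    rw [hcomp] at hslice
    have h (s : ℝ) : HasDerivAt (fun s => Real.log (1 + Real.exp s))
        (Real.exp s / (1 + Real.exp s)) s :=
      ((Real.hasDerivAt_exp s).const_add 1).log (hsp s)
    have hexpl := (HasDerivAt.comp_hasFDerivAt (z₀, z₁) (h z₀)
      (hasFDerivAt_fst (𝕜 := ℝ) (E := ℝ) (F := ℝ) (p := (z₀, z₁)))).prodMk
      (HasDerivAt.comp_hasFDerivAt (z₀, z₁) (h z₁)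
        (hasFDerivAt_snd (𝕜 := ℝ) (E := ℝ) (F := ℝ) (p := (z₀, z₁))))
    have heq := hslice.unique hexpl
    intro y
    refine ⟨((1 + Real.exp z₀) / Real.exp z₀ * y.1, (1 + Real.exp z₁) / Real.exp z₁ * y.2), ?_⟩
    have := DFunLike.congr_fun heq
      ((1 + Real.exp z₀) / Real.exp z₀ * y.1, (1 + Real.exp z₁) / Real.exp z₁ * y.2)
    simp at this
    rw [this]
    have := hsp z₀
    have := hsp z₁
    ext <;> simp <;> field_simp
  have hev := hstrict.eventually_exists_eq hsurj
  have hlim : Tendsto (fun (t : ℝ) (k : κ) => Real.exp (-(t * d k))) atTop (𝓝 0) := by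
    rw [tendsto_pi_nhds]
    intro k
    exact Real.tendsto_exp_neg_atTop_nhds_zero.comp (tendsto_id.atTop_mul_const (hd k))
  obtain ⟨t, ⟨s₀, s₁⟩, hs⟩ := (hlim.eventually hev).exists
  rw [hf0] at hs
  simp only [f, Prod.mk.injEq, ← Real.exp_add, ← sub_eq_add_neg] at hs
  exact ⟨t, s₀, s₁, by linarith [hs.1], by linarith [hs.2]⟩

/-- A space `V` of functions on the vertices of a pentagon containing the constants and, for every
edge `{i, i + 1}`, a function `ℓ i` vanishing on that edge and positive elsewhere. -/
structure PentagonSpace (V : Submodule ℝ (Fin 5 → ℝ)) (ℓ : Fin 5 → Fin 5 → ℝ) : Prop where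
  one_mem : 1 ∈ V
  mem (i : Fin 5) : ℓ i ∈ V
  left (i : Fin 5) : ℓ i i = 0
  right (i : Fin 5) : ℓ i (i + 1) = 0
  eq_smul (i : Fin 5) (f) : f ∈ V → f i = 0 → f (i + 1) = 0 → ∃ κ : ℝ, f = κ • ℓ i
  pos (i x : Fin 5) : x ≠ i → x ≠ i + 1 → 0 < ℓ i x

namespace PentagonSpace

variable {V : Submodule ℝ (Fin 5 → ℝ)} {ℓ : Fin 5 → Fin 5 → ℝ}

lemma pos' (h : PentagonSpace V ℓ) {i x : Fin 5} (hx : x ≠ i ∧ x ≠ i + 1) : 0 < ℓ i x :=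
  h.pos i x hx.1 hx.2

lemma right' (h : PentagonSpace V ℓ) {i x : Fin 5} (hx : i + 1 = x) : ℓ i x = 0 :=
  hx ▸ h.right i

lemma exists_interpolation (h : PentagonSpace V ℓ) (i : Fin 5) (c : Fin 5 → ℝ) :
    ∃ u ∈ V, ∀ x, x ≠ i → x ≠ i + 1 → u x = c x := by
  have hcases : ∀ x, x ≠ i → x ≠ i + 1 → x = i + 2 ∨ x = i + 3 ∨ x = i + 4 := by
    revert i; decide
  have h4 : 0 < ℓ (i + 2) (i + 4) := h.pos' (by clear * -; revert i; decide)
  have h2 : 0 < ℓ (i + 3) (i + 2) := h.pos' (by clear * -; revert i; decide)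
  have z22 := h.left (i + 2)
  have z33 := h.left (i + 3)
  have z23 : ℓ (i + 2) (i + 3) = 0 := h.right' (by clear * -; revert i; decide)
  have z34 : ℓ (i + 3) (i + 4) = 0 := h.right' (by clear * -; revert i; decide)
  refine ⟨c (i + 3) • 1 + ((c (i + 4) - c (i + 3)) / ℓ (i + 2) (i + 4)) • ℓ (i + 2) +
    ((c (i + 2) - c (i + 3)) / ℓ (i + 3) (i + 2)) • ℓ (i + 3),
    V.add_mem (V.add_mem (V.smul_mem _ h.one_mem) (V.smul_mem _ (h.mem _)))
      (V.smul_mem _ (h.mem _)), fun x hx hx' => ?_⟩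
  rcases hcases x hx hx' with rfl | rfl | rfl
  · simp [z22, h2.ne']
  · simp [z23, z33]
  · simp [z34, h4.ne']

lemma exists_softplus_eq (h : PentagonSpace V ℓ) (i : Fin 5) {r : Fin 5 → ℝ} (hr : 0 < r i)
    (hr' : 0 < r (i + 1)) (hr0 : ∀ x, x ≠ i → x ≠ i + 1 → r x = 0) :
    ∃ s ∈ V, ∃ v ∈ V, ∀ x, Real.log (1 + Real.exp (s x)) = r x + v x := by
  have hi : 0 < ℓ (i + 1) i := h.pos' (by clear * -; revert i; decide)
  have hi' : 0 < ℓ (i + 4) (i + 1) := h.pos' (by clear * -; revert i; decide)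
  have z1 := h.left (i + 1)
  have z4 : ℓ (i + 4) i = 0 := h.right' (by clear * -; revert i; decide)
  let Q : Fin 5 → ℝ := (ℓ (i + 1) i)⁻¹ • ℓ (i + 1)
  let R : Fin 5 → ℝ := (ℓ (i + 4) (i + 1))⁻¹ • ℓ (i + 4)
  choose B hBV hB using fun k : Fin 5 => h.exists_interpolation i (Pi.single k 1)
  obtain ⟨t, s₀, s₁, hs₀, hs₁⟩ := exists_softplus_eq_add_sum
    (κ := {x : Fin 5 // x ≠ i ∧ x ≠ i + 1}) hr hr' (fun k => B k i) (fun k => B k (i + 1))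
    (fun k => Q k) (fun k => R k) (fun k => ℓ i k) (fun k => h.pos' k.2)
  let s : Fin 5 → ℝ := s₀ • Q + s₁ • R - t • ℓ i
  have hsi : s i = s₀ := by simp [s, Q, R, hi.ne', z4, h.left i]
  have hsi' : s (i + 1) = s₁ := by simp [s, Q, R, hi'.ne', z1, h.right i]
  refine ⟨s, V.sub_mem (V.add_mem (V.smul_mem _ (V.smul_mem _ (h.mem _)))
    (V.smul_mem _ (V.smul_mem _ (h.mem _)))) (V.smul_mem _ (h.mem _)),
    ∑ k : {x : Fin 5 // x ≠ i ∧ x ≠ i + 1}, Real.log (1 + Real.exp (s k)) • B k,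
    V.sum_mem fun k _ => V.smul_mem _ (hBV k), fun x => ?_⟩
  by_cases hx : x = i
  · subst hx
    rw [hsi, hs₀]
    simp [s, mul_comm]
  by_cases hx' : x = i + 1
  · subst hx'
    rw [hsi', hs₁]
    simp [s, mul_comm]
  · rw [hr0 x hx hx', Finset.sum_apply, Finset.sum_eq_single ⟨x, hx, hx'⟩]
    · simp [hB x x hx hx']
    · intro k _ hk
      have : x ≠ k := fun e => hk (Subtype.ext e.symm)
      simp [hB k x hx hx', this]
    · simp

end PentagonSpace

lemma Fin.sum_univ_five_rotate (f : Fin 5 → ℝ) (i : Fin 5) :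
    ∑ x, f x = f i + f (i + 1) + f (i + 2) + f (i + 3) + f (i + 4) := by
  rw [← Equiv.sum_comp (Equiv.addLeft i), Fin.sum_univ_five]
  simp

/-- Signs around a pentagon: if each three consecutive signs all vanish or include both
`1` and `-1`, then there are three consecutive alternating signs. -/
lemma SignType.exists_alternating (σ : Fin 5 → SignType) (h0 : ∃ i, σ i ≠ 0)
    (h : ∀ i, (σ i = 0 ∧ σ (i + 1) = 0 ∧ σ (i + 2) = 0) ∨
      ((σ i = 1 ∨ σ (i + 1) = 1 ∨ σ (i + 2) = 1) ∧
        (σ i = -1 ∨ σ (i + 1) = -1 ∨ σ (i + 2) = -1))) :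
    ∃ i, σ i ≠ 0 ∧ σ (i + 1) = -σ i ∧ σ (i + 2) = σ i := by
  have key : ∀ a b c d e : SignType, let σ := ![a, b, c, d, e]
      (∃ i, σ i ≠ 0) → (∀ i : Fin 5, (σ i = 0 ∧ σ (i + 1) = 0 ∧ σ (i + 2) = 0) ∨
      ((σ i = 1 ∨ σ (i + 1) = 1 ∨ σ (i + 2) = 1) ∧
        (σ i = -1 ∨ σ (i + 1) = -1 ∨ σ (i + 2) = -1))) →
      ∃ i, σ i ≠ 0 ∧ σ (i + 1) = -σ i ∧ σ (i + 2) = σ i := by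
    decide
  have hσ : σ = ![σ 0, σ 1, σ 2, σ 3, σ 4] := by ext i; fin_cases i <;> rfl
  rw [hσ] at h0 h ⊢
  exact key _ _ _ _ _ h0 h

lemma SignType.eq_zero_or_both_of_sum_eq_zero {a b c p q r : ℝ} (hp : 0 < p) (hq : 0 < q) (hr : 0 < r)
    (h : a * p + b * q + c * r = 0) :
    (SignType.sign a = 0 ∧ SignType.sign b = 0 ∧ SignType.sign c = 0) ∨
      ((SignType.sign a = 1 ∨ SignType.sign b = 1 ∨ SignType.sign c = 1) ∧
        (SignType.sign a = -1 ∨ SignType.sign b = -1 ∨ SignType.sign c = -1)) := by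
  simp only [sign_eq_zero_iff, sign_eq_one_iff, sign_eq_neg_one_iff]
  have aux : ∀ x y z : ℝ, x * p + y * q + z * r = 0 → 0 ≤ x → 0 ≤ y → 0 ≤ z →
      x = 0 ∧ y = 0 ∧ z = 0 := by
    intro x y z e hx hy hz
    have h1 := mul_nonneg hx hp.le
    have h2 := mul_nonneg hy hq.le
    have h3 := mul_nonneg hz hr.le
    refine ⟨?_, ?_, ?_⟩
    · exact (mul_eq_zero_iff_right hp.ne').1 (by linarith)
    · exact (mul_eq_zero_iff_right hq.ne').1 (by linarith)
    · exact (mul_eq_zero_iff_right hr.ne').1 (by linarith)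
  by_contra! hcon
  obtain ⟨h1, h2⟩ := hcon
  by_cases hpos : 0 < a ∨ 0 < b ∨ 0 < c
  · obtain ⟨ha, hb, hc⟩ := h2 hpos
    obtain ⟨rfl, rfl, rfl⟩ := aux a b c h ha hb hc
    simp at hpos
  · push Not at hpos
    obtain ⟨ha, hb, hc⟩ := hpos
    obtain ⟨ha, hb, hc⟩ := aux (-a) (-b) (-c) (by linarith) (by linarith) (by linarith)
      (by linarith)
    exact h1 (by linarith) (by linarith) (by linarith)

namespace PentagonSpace

variable {V : Submodule ℝ (Fin 5 → ℝ)} {ℓ : Fin 5 → Fin 5 → ℝ}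

/-- Up to `V`, every `c` is either zero or positive on an edge and zero off it. -/
lemma exists_eq_add_edge (h : PentagonSpace V ℓ) {c D : Fin 5 → ℝ} (hD : D ≠ 0)
    (hDV : ∀ f ∈ V, ∑ x, D x * f x = 0) (hDc : ∑ x, D x * c x = 0) :
    c ∈ V ∨ ∃ u ∈ V, ∃ i, 0 < c i - u i ∧ 0 < c (i + 1) - u (i + 1) ∧
      ∀ x, x ≠ i → x ≠ i + 1 → c x - u x = 0 := by
  obtain ⟨i, hi0, hi1, hi2⟩ := SignType.exists_alternating (fun i => SignType.sign (D i))
    (by simpa [funext_iff] using hD) (fun i => by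
      have e := hDV _ (h.mem (i + 3))
      have z3 := h.left (i + 3)
      have z4 : ℓ (i + 3) (i + 4) = 0 := h.right' (by clear * -; revert i; decide)
      have p0 : 0 < ℓ (i + 3) i := h.pos' (by clear * -; revert i; decide)
      have p1 : 0 < ℓ (i + 3) (i + 1) := h.pos' (by clear * -; revert i; decide)
      have p2 : 0 < ℓ (i + 3) (i + 2) := h.pos' (by clear * -; revert i; decide)
      rw [Fin.sum_univ_five_rotate _ i, z3, z4] at e
      exact SignType.eq_zero_or_both_of_sum_eq_zero p0 p1 p2 (by linarith))
  wlog hpos : 0 < D i generalizing D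
  · have hneg : 0 < -D i := by
      have : D i ≠ 0 := by simpa using hi0
      have := lt_of_le_of_ne (not_lt.1 hpos) this
      linarith
    refine this (D := -D) (neg_ne_zero.2 hD) (fun f hf => by simp [hDV f hf])
      (by simp [hDc]) ?_ ?_ ?_ hneg
    · simpa using hi0
    · simp [Left.sign_neg, hi1]
    · simp [Left.sign_neg, hi2]
  have hs : SignType.sign (D i) = 1 := sign_pos hpos
  simp only [hs, sign_eq_neg_one_iff, sign_eq_one_iff] at hi1 hi2
  -- Compare the interpolations off the edges `{i, i + 1}` and `{i + 1, i + 2}`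
  obtain ⟨u, hu, hcu⟩ := h.exists_interpolation i c
  obtain ⟨v, hv, hcv⟩ := h.exists_interpolation (i + 1) c
  have i12 : i + 1 + 1 = i + 2 := by clear * -; revert i; decide
  rw [i12] at hcv
  have u2 := hcu (i + 2) (by clear * -; revert i; decide) (by clear * -; revert i; decide)
  have u3 := hcu (i + 3) (by clear * -; revert i; decide) (by clear * -; revert i; decide)
  have u4 := hcu (i + 4) (by clear * -; revert i; decide) (by clear * -; revert i; decide)
  have v0 := hcv i (by clear * -; revert i; decide) (by clear * -; revert i; decide)
  have v3 := hcv (i + 3) (by clear * -; revert i; decide) (by clear * -; revert i; decide)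
  have v4 := hcv (i + 4) (by clear * -; revert i; decide) (by clear * -; revert i; decide)
  have eu := hDV u hu
  have ev := hDV v hv
  rw [Fin.sum_univ_five_rotate _ i] at eu ev hDc
  rw [u2, u3, u4] at eu
  rw [v0, v3, v4] at ev
  have eu' : D i * (c i - u i) = -D (i + 1) * (c (i + 1) - u (i + 1)) := by linarith
  have ev' : D (i + 2) * (c (i + 2) - v (i + 2)) = -D (i + 1) * (c (i + 1) - v (i + 1)) := by
    linarith
  have hn1 : 0 < -D (i + 1) := by linarith
  rcases lt_trichotomy (c (i + 1) - u (i + 1)) 0 with hlt | heq | hgt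
  · rcases lt_trichotomy (c (i + 1) - v (i + 1)) 0 with hlt' | heq' | hgt'
    · exfalso
      -- `u - v` vanishes on the edge `{i + 3, i + 4}` but has mixed signs off it
      obtain ⟨κ, hκ⟩ := h.eq_smul (i + 3) (u - v) (V.sub_mem hu hv) (by simp [u3, v3])
        (by rw [show i + 3 + 1 = i + 4 by clear * -; revert i; decide]; simp [u4, v4])
      have p0 : 0 < ℓ (i + 3) i := h.pos' (by clear * -; revert i; decide)
      have p2 : 0 < ℓ (i + 3) (i + 2) := h.pos' (by clear * -; revert i; decide)
      have k0 : u i - c i = κ * ℓ (i + 3) i := by simpa [v0] using congrFun hκ i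
      have k2 : c (i + 2) - v (i + 2) = κ * ℓ (i + 3) (i + 2) := by
        simpa [u2] using congrFun hκ (i + 2)
      have n0 := mul_neg_of_pos_of_neg hn1 hlt
      have n2 := mul_neg_of_pos_of_neg hn1 hlt'
      rw [← eu'] at n0
      rw [← ev', k2] at n2
      have hκneg : κ < 0 := neg_of_mul_neg_left (neg_of_mul_neg_right n2 hi2.le) p2.le
      have hκpos : 0 < κ * ℓ (i + 3) i := by linarith [neg_of_mul_neg_right n0 hpos.le]
      exact hκneg.not_gt ((mul_pos_iff_of_pos_right p0).1 hκpos)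
    · left
      rw [heq', mul_zero, mul_eq_zero_iff_left hi2.ne'] at ev'
      convert hv using 1
      ext x
      by_cases hx : x = i + 1
      · subst hx; linarith
      by_cases hx' : x = i + 2
      · subst hx'; linarith
      · exact (hcv x hx hx').symm
    · right
      refine ⟨v, hv, i + 1, hgt', ?_, ?_⟩
      · rw [i12]
        have := mul_pos hn1 hgt'
        rw [← ev'] at this
        exact (mul_pos_iff_of_pos_left hi2).1 this
      · rw [i12]
        intro x hx hx'
        rw [hcv x hx hx', sub_self]
  · left
    rw [heq, mul_zero, mul_eq_zero_iff_left hpos.ne'] at eu'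
    convert hu using 1
    ext x
    by_cases hx : x = i
    · subst hx; linarith
    by_cases hx' : x = i + 1
    · subst hx'; linarith
    · exact (hcu x hx hx').symm
  · right
    refine ⟨u, hu, i, ?_, hgt, fun x hx hx' => by rw [hcu x hx hx', sub_self]⟩
    have := mul_pos hn1 hgt
    rw [← eu'] at this
    exact (mul_pos_iff_of_pos_left hpos).1 this

end PentagonSpace

/-- The values at the points `A x` of the affine functions on `ℝ^d`. -/
def affineValues {X : Type*} {d : ℕ} (A : X → Fin d → ℝ) : Submodule ℝ (X → ℝ) where
  carrier := {f | ∃ (k : ℝ) (θ : Fin d → ℝ), ∀ x, f x = k + ∑ j, θ j * A x j}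
  zero_mem' := ⟨0, 0, by simp⟩
  add_mem' := by
    rintro f g ⟨k, θ, hf⟩ ⟨k', θ', hg⟩
    refine ⟨k + k', θ + θ', fun x => ?_⟩
    simp only [Pi.add_apply, hf, hg, add_mul, Finset.sum_add_distrib]
    ring
  smul_mem' := by
    rintro r f ⟨k, θ, hf⟩
    refine ⟨r * k, r • θ, fun x => ?_⟩
    simp only [Pi.smul_apply, hf, smul_eq_mul, mul_add, Finset.mul_sum, mul_assoc]

lemma mem_affineValues {X : Type*} {d : ℕ} {A : X → Fin d → ℝ} {f : X → ℝ} :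
    f ∈ affineValues A ↔ ∃ (k : ℝ) (θ : Fin d → ℝ), ∀ x, f x = k + ∑ j, θ j * A x j :=
  Iff.rfl

lemma exists_expFam_of_mem_affineValues {X : Type*} [Fintype X] [Nonempty X] {d : ℕ}
    {A : X → Fin d → ℝ} {u : X → ℝ} (hu : u ∈ affineValues A) :
    ∃ f ∈ expFam A, ∀ x, Real.exp (u x) = (∑ y, Real.exp (u y)) * f x := by
  obtain ⟨k, θ, h⟩ := mem_affineValues.1 hu
  refine ⟨_, ⟨θ, fun x => rfl⟩, fun x => ?_⟩
  have : 0 < ∑ y, Real.exp (∑ j, θ j * A y j) :=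
    Finset.sum_pos (fun y _ => Real.exp_pos _) Finset.univ_nonempty
  simp only [h, Real.exp_add, ← Finset.mul_sum]
  field_simp

/-- Two linear forms on the plane vanishing on a common nonzero vector are proportional. -/
lemma exists_eq_smul_of_orthogonal {θ φ δ : Fin 2 → ℝ} (hδ : δ ≠ 0) (hφ : φ ≠ 0)
    (h : ∑ j, θ j * δ j = 0) (h' : ∑ j, φ j * δ j = 0) : ∃ κ : ℝ, θ = κ • φ := by
  rw [Fin.sum_univ_two] at h h'
  have hcross : θ 0 * φ 1 - θ 1 * φ 0 = 0 := by
    by_contra hne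
    apply hδ
    ext j
    fin_cases j
    · refine (mul_eq_zero.1 ?_).resolve_left hne
      simp only [Fin.zero_eta]
      linear_combination φ 1 * h - θ 1 * h'
    · refine (mul_eq_zero.1 ?_).resolve_left hne
      simp only [Fin.mk_one]
      linear_combination θ 0 * h' - φ 0 * h
  have hN : φ 0 ^ 2 + φ 1 ^ 2 ≠ 0 := by
    intro hN
    apply hφ
    ext j
    fin_cases j <;> simp <;> nlinarith [sq_nonneg (φ 0), sq_nonneg (φ 1)]
  refine ⟨(θ 0 * φ 0 + θ 1 * φ 1) / (φ 0 ^ 2 + φ 1 ^ 2), ?_⟩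
  ext j
  fin_cases j <;> simp <;> field_simp
  · linear_combination φ 1 * hcross
  · linear_combination -φ 0 * hcross

/-- An affine function vanishing on an exposed edge and positive at all other vertices. -/
lemma exists_exposing_functional {X : Type*} {d : ℕ} {A : X → Fin d → ℝ}
    (hinj : Function.Injective A)
    (hext : Set.extremePoints ℝ (convexHull ℝ (Set.range A)) = Set.range A) {i j : X}
    (hface : IsExposed ℝ (convexHull ℝ (Set.range A)) (convexHull ℝ {A i, A j})) :
    ∃ g ∈ affineValues A, g i = 0 ∧ g j = 0 ∧ ∀ x, x ≠ i → x ≠ j → 0 < g x := by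
  have hA (x : X) : A x ∈ convexHull ℝ (Set.range A) := subset_convexHull ℝ _ ⟨x, rfl⟩
  have hi : A i ∈ convexHull ℝ {A i, A j} := subset_convexHull ℝ _ (by simp)
  have hj : A j ∈ convexHull ℝ {A i, A j} := subset_convexHull ℝ _ (by simp)
  obtain ⟨l, hl⟩ := hface ⟨_, hi⟩
  have hi' := hi
  have hj' := hj
  rw [hl] at hi' hj'
  refine ⟨fun x => l (A i) - l (A x), ?_, sub_self _,
    sub_eq_zero.2 (le_antisymm (hj'.2 _ (hA i)) (hi'.2 _ (hA j))), fun x hxi hxj => ?_⟩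
  · refine mem_affineValues.2 ⟨l (A i), fun k => -l (Pi.single k 1), fun x => ?_⟩
    have : l (A x) = ∑ k, A x k * l (Pi.single k 1) := by
      conv_lhs => rw [pi_eq_sum_univ' (A x)]
      simp [map_sum]
    simp [this, sub_eq_add_neg, mul_comm]
  · refine sub_pos.2 (lt_of_le_of_ne (hi'.2 _ (hA x)) fun heq => ?_)
    have hx : A x ∈ convexHull ℝ {A i, A j} := by
      rw [hl]
      exact ⟨hA x, fun y hy => heq ▸ hi'.2 y hy⟩
    rw [convexHull_pair] at hx
    have hxe : A x ∈ Set.extremePoints ℝ (convexHull ℝ (Set.range A)) := by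
      rw [hext]; exact ⟨x, rfl⟩
    rcases (mem_extremePoints_iff_forall_segment.1 hxe).2 _ (hA i) _ (hA j) hx with h | h
    · exact hxi (hinj h.symm)
    · exact hxj (hinj h.symm)

lemma exists_pentagonSpace {A : Fin 5 → Fin 2 → ℝ} (hinj : Function.Injective A)
    (hext : Set.extremePoints ℝ (convexHull ℝ (Set.range A)) = Set.range A)
    (hfaces : ∀ i : Fin 5, IsExposed ℝ (convexHull ℝ (Set.range A))
      (convexHull ℝ {A i, A (i + 1)})) :
    ∃ ℓ, PentagonSpace (affineValues A) ℓ := by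
  choose ℓ hV hl hr hpos using fun i => exists_exposing_functional hinj hext (hfaces i)
  refine ⟨ℓ, ⟨1, 0, by simp⟩, hV, hl, hr, fun i f hf hfi hfi' => ?_, hpos⟩
  obtain ⟨k, θ, hθ⟩ := mem_affineValues.1 hf
  obtain ⟨m, φ, hφ⟩ := mem_affineValues.1 (hV i)
  have hδ : A (i + 1) - A i ≠ 0 :=
    sub_ne_zero.2 (hinj.ne (by clear * -; revert i; decide))
  have h2 : 0 < ℓ i (i + 2) := by
    apply hpos <;> (clear * -; revert i; decide)
  have hl' := hl i
  have hr' := hr i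
  have hφ0 : φ ≠ 0 := by
    rintro rfl
    rw [hφ] at hl' h2
    simp only [Pi.zero_apply, zero_mul, Finset.sum_const_zero] at hl' h2
    linarith
  rw [hφ] at hl' hr'
  rw [hθ] at hfi hfi'
  obtain ⟨κ, rfl⟩ := exists_eq_smul_of_orthogonal (θ := θ) hδ hφ0
    (by simp only [Pi.sub_apply, mul_sub, Finset.sum_sub_distrib]; linarith)
    (by simp only [Pi.sub_apply, mul_sub, Finset.sum_sub_distrib]; linarith)
  refine ⟨κ, funext fun x => ?_⟩
  simp only [Pi.smul_apply, smul_eq_mul, hθ, hφ, mul_assoc, ← Finset.mul_sum] at hfi ⊢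
  linear_combination hfi - κ * hl'

/-- Five points of the plane carry a nontrivial affine dependency orthogonal to a given vector. -/
lemma exists_affine_dependency (A : Fin 5 → Fin 2 → ℝ) (c : Fin 5 → ℝ) :
    ∃ D : Fin 5 → ℝ, D ≠ 0 ∧ (∀ f ∈ affineValues A, ∑ x, D x * f x = 0) ∧
      ∑ x, D x * c x = 0 := by
  let M : Matrix (Fin 4) (Fin 5) ℝ := ![1, fun x => A x 0, fun x => A x 1, c]
  obtain ⟨D, hD, hD0⟩ := (Submodule.ne_bot_iff _).1
    (LinearMap.ker_ne_bot_of_finrank_lt (f := M.mulVecLin) (by simp))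
  have hD' : M.mulVec D = 0 := hD
  have h0 : ∑ x, D x = 0 := by
    simpa [M, Matrix.mulVec, dotProduct] using congrFun hD' 0
  have h1 : ∑ x, D x * A x 0 = 0 := by
    simpa [M, Matrix.mulVec, dotProduct, mul_comm] using congrFun hD' 1
  have h2 : ∑ x, D x * A x 1 = 0 := by
    simpa [M, Matrix.mulVec, dotProduct, mul_comm] using congrFun hD' 2
  have h3 : ∑ x, D x * c x = 0 := by
    simpa [M, Matrix.mulVec, dotProduct, mul_comm] using congrFun hD' 3
  refine ⟨D, hD0, fun f hf => ?_, h3⟩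
  obtain ⟨k, θ, h⟩ := mem_affineValues.1 hf
  calc ∑ x, D x * f x
      = k * ∑ x, D x + θ 0 * ∑ x, D x * A x 0 + θ 1 * ∑ x, D x * A x 1 := by
        simp only [h, Fin.sum_univ_two, Finset.mul_sum, ← Finset.sum_add_distrib]
        exact Finset.sum_congr rfl fun x _ => by ring
    _ = 0 := by simp [h0, h1, h2]

lemma PentagonSpace.exists_exp_add_exp {A : Fin 5 → Fin 2 → ℝ} {ℓ : Fin 5 → Fin 5 → ℝ}
    (h : PentagonSpace (affineValues A) ℓ) {p : Fin 5 → ℝ} (hp : ∀ x, 0 < p x) :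
    ∃ u ∈ affineValues A, ∃ v ∈ affineValues A, ∀ x, p x = Real.exp (u x) + Real.exp (v x) := by
  obtain ⟨D, hD, hDV, hDc⟩ := exists_affine_dependency A fun x => Real.log (p x)
  rcases h.exists_eq_add_edge hD hDV hDc with hc | ⟨w, hw, i, hi, hi', hi0⟩
  · have hmem := Submodule.sub_mem _ hc (Submodule.smul_mem _ (Real.log 2) h.one_mem)
    refine ⟨_, hmem, _, hmem, fun x => ?_⟩
    simp [Real.exp_sub, Real.exp_log (hp x), Real.exp_log]
  · obtain ⟨s, hs, v, hv, hsv⟩ :=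
      h.exists_softplus_eq i (r := fun x => Real.log (p x) - w x) hi hi' hi0
    refine ⟨w - v, Submodule.sub_mem _ hw hv, w - v + s,
      Submodule.add_mem _ (Submodule.sub_mem _ hw hv) hs, fun x => ?_⟩
    have hlog : Real.log (p x) = (w - v) x + Real.log (1 + Real.exp (s x)) := by
      rw [hsv, Pi.sub_apply]; ring
    rw [← Real.exp_log (hp x), hlog, Real.exp_add, Real.exp_log (by positivity), Pi.add_apply,
      Real.exp_add]
    ring

/-- for a two-dimensional exponential family whose convex
support is a pentagon with vertices `A 0, …, A 4` and edges
`[A i, A (i+1 mod 5)]` exposed, every strictly positive distribution on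
`{0,…,4}` is a convex combination of two elements of the family. -/
theorem stmt_19 (A : Fin 5 → Fin 2 → ℝ)
    (hinj : Function.Injective A)
    (hext : Set.extremePoints ℝ (convexHull ℝ (Set.range A)) = Set.range A)
    (hfaces : ∀ i : Fin 5, IsExposed ℝ (convexHull ℝ (Set.range A))
      (convexHull ℝ {A i, A (i + 1)}))
    (p : Fin 5 → ℝ) (hp : IsDist p) (hpos : ∀ x, 0 < p x) :
    ∃ (α₁ α₂ : ℝ) (f₁ f₂ : Fin 5 → ℝ),
      0 ≤ α₁ ∧ 0 ≤ α₂ ∧ α₁ + α₂ = 1 ∧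
      f₁ ∈ expFam A ∧ f₂ ∈ expFam A ∧
      ∀ x, p x = α₁ * f₁ x + α₂ * f₂ x := by
  obtain ⟨ℓ, hℓ⟩ := exists_pentagonSpace hinj hext hfaces
  obtain ⟨u, hu, v, hv, huv⟩ := hℓ.exists_exp_add_exp hpos
  obtain ⟨f, hf, huf⟩ := exists_expFam_of_mem_affineValues hu
  obtain ⟨g, hg, hvg⟩ := exists_expFam_of_mem_affineValues hv
  refine ⟨∑ y, Real.exp (u y), ∑ y, Real.exp (v y), f, g,
    Finset.sum_nonneg fun _ _ => (Real.exp_pos _).le,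
    Finset.sum_nonneg fun _ _ => (Real.exp_pos _).le, ?_, hf, hg, fun x => by rw [huv, huf, hvg]⟩
  rw [← Finset.sum_add_distrib, ← hp.2]
  exact Finset.sum_congr rfl fun x _ => (huv x).symm
end
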